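/- Let T > 0, σ_Y > 0, γ° > 0 and continuous functions β1, β3 : [0,T] → ℝ. Define α(t, χ) := β3(t) + β1(t)·χ. Then the initial value problem γ'(t) = −γ(t)²·α(t, χ(t))²/σ_Y² with γ(0) = γ°, and χ'(t) = γ(t)·α(t, χ(t))²·(1 − χ(t))/σ_Y² with χ(0) = 0, has a unique C¹ solution (γ, χ) on [0,T], and it satisfies χ(t) = 1 − γ(t)/γ° for all t ∈ [0,T]. -/

import Mathlib

open Set

/-- A pair `(γ, χ)` solving the learning ODEs in the no-feedback case
(uninformative public signal), with `α = β3 + β1·χ`. -/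
def NFLearnSol (T σY γo : ℝ) (β1 β3 γ χ : ℝ → ℝ) : Prop :=
  ContDiffOn ℝ 1 γ (Icc 0 T) ∧ ContDiffOn ℝ 1 χ (Icc 0 T) ∧
  (∀ t ∈ Icc (0:ℝ) T,
    HasDerivWithinAt γ (-(γ t)^2 * (β3 t + β1 t * χ t)^2 / σY^2) (Icc 0 T) t) ∧
  (∀ t ∈ Icc (0:ℝ) T,
    HasDerivWithinAt χ
      (γ t * (β3 t + β1 t * χ t)^2 * (1 - χ t) / σY^2) (Icc 0 T) t) ∧
  γ 0 = γo ∧ χ 0 = 0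

/-- A solution of the linear equation `f' = g f` with continuous `g` that vanishes at the left
endpoint vanishes identically. -/
theorem eq_zero_of_hasDerivWithinAt_mul_self {a b : ℝ} {f g : ℝ → ℝ}
    (hg : ContinuousOn g (Icc a b))
    (hf : ∀ t ∈ Icc a b, HasDerivWithinAt f (g t * f t) (Icc a b) t) (ha : f a = 0) :
    ∀ t ∈ Icc a b, f t = 0 := by
  obtain ⟨K, hK⟩ := isCompact_Icc.exists_bound_of_continuousOn hg
  refine eq_zero_of_abs_deriv_le_mul_abs_self_of_eq_zero_right (f' := fun t => g t * f t) (K := K)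
    (HasDerivWithinAt.continuousOn hf) (fun t ht => ?_) ha (fun t ht => ?_)
  · exact (hf t (Ico_subset_Icc_self ht)).mono_of_mem_nhdsWithin
      (Icc_mem_nhdsGE_of_mem ht)
  · rw [norm_mul]
    exact mul_le_mul_of_nonneg_right (hK t (Ico_subset_Icc_self ht)) (norm_nonneg _)

theorem contDiffOn_one_Icc_of_hasDerivWithinAt {a b : ℝ} (hab : a < b) {f f' : ℝ → ℝ}
    (hf : ∀ t ∈ Icc a b, HasDerivWithinAt f (f' t) (Icc a b) t)
    (hf' : ContinuousOn f' (Icc a b)) : ContDiffOn ℝ 1 f (Icc a b) := by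
  have hu := uniqueDiffOn_Icc hab
  rw [contDiffOn_one_iff_derivWithin hu]
  exact ⟨fun t ht => (hf t ht).differentiableWithinAt,
    hf'.congr fun t ht => (hf t ht).derivWithin (hu t ht)⟩

theorem abs_inv_max_one_sub_inv_max_one_le (x y : ℝ) :
    |(max x 1)⁻¹ - (max y 1)⁻¹| ≤ |x - y| := by
  have hx : (1 : ℝ) ≤ max x 1 := le_max_right _ _
  have hy : (1 : ℝ) ≤ max y 1 := le_max_right _ _
  have hxy : 1 ≤ max x 1 * max y 1 := one_le_mul_of_one_le_of_one_le hx hy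
  rw [inv_sub_inv (by positivity) (by positivity), abs_div, abs_sub_comm,
    abs_of_pos (by positivity : 0 < max x 1 * max y 1)]
  exact (div_le_self (abs_nonneg _) hxy).trans (abs_max_sub_max_le_abs x y 1)

/-- Global solvability of the equation for the normalized precision `w = γ° / γ`. -/
theorem exists_precision_solution {T c : ℝ} (hT : 0 ≤ T) (hc : 0 ≤ c) {β1 β3 : ℝ → ℝ}
    (hβ1 : ContinuousOn β1 (Icc 0 T)) (hβ3 : ContinuousOn β3 (Icc 0 T)) :
    ∃ w : ℝ → ℝ, w 0 = 1 ∧ ∀ t ∈ Icc (0 : ℝ) T, 1 ≤ w t ∧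
      HasDerivWithinAt w (c * (β3 t + β1 t * (1 - (w t)⁻¹)) ^ 2) (Icc 0 T) t := by
  obtain ⟨B1, hB1⟩ := isCompact_Icc.exists_bound_of_continuousOn hβ1
  obtain ⟨B3, hB3⟩ := isCompact_Icc.exists_bound_of_continuousOn hβ3
  set B := max B1 B3
  have h0 : (0 : ℝ) ∈ Icc 0 T := ⟨le_rfl, hT⟩
  have hb1 : ∀ t ∈ Icc (0 : ℝ) T, |β1 t| ≤ B := fun t ht => (hB1 t ht).trans (le_max_left _ _)
  have hb3 : ∀ t ∈ Icc (0 : ℝ) T, |β3 t| ≤ B := fun t ht => (hB3 t ht).trans (le_max_right _ _)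
  have hB : 0 ≤ B := (abs_nonneg _).trans (hb1 0 h0)
  set α : ℝ → ℝ → ℝ := fun t x => β3 t + β1 t * (1 - (max x 1)⁻¹) with hα
  have hαB : ∀ t ∈ Icc (0 : ℝ) T, ∀ x, |α t x| ≤ 2 * B := by
    intro t ht x
    have h1 : (1 : ℝ) ≤ max x 1 := le_max_right _ _
    have h2 : (max x 1)⁻¹ ≤ 1 := inv_le_one_of_one_le₀ h1
    have h3 : 0 ≤ (max x 1)⁻¹ := by positivity
    have h4 : |1 - (max x 1)⁻¹| ≤ 1 := abs_le.2 ⟨by linarith, by linarith⟩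
    calc |α t x| ≤ |β3 t| + |β1 t| * |1 - (max x 1)⁻¹| := by
          rw [← abs_mul]; exact abs_add_le _ _
      _ ≤ B + B * 1 := add_le_add (hb3 t ht) (mul_le_mul (hb1 t ht) h4 (abs_nonneg _) hB)
      _ = 2 * B := by ring
  set L : NNReal := ⟨c * (4 * B ^ 2), by positivity⟩
  have hPL : IsPicardLindelof (fun t x => c * α t x ^ 2) (⟨0, h0⟩ : Icc (0 : ℝ) T) (1 : ℝ)
      (L * T.toNNReal) 0 L L := by
    refine ⟨fun t ht => ?_, fun x _ => ?_, fun t ht x _ => ?_, ?_⟩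
    · refine (LipschitzWith.of_dist_le_mul fun x y => ?_).lipschitzOnWith
      rw [Real.dist_eq, Real.dist_eq]
      have e : c * α t x ^ 2 - c * α t y ^ 2
          = c * ((α t x + α t y) * (β1 t * ((max y 1)⁻¹ - (max x 1)⁻¹))) := by
        simp only [hα]; ring
      have hs : |α t x + α t y| ≤ 4 * B :=
        (abs_add_le _ _).trans (by linarith [hαB t ht x, hαB t ht y])
      have hm := abs_inv_max_one_sub_inv_max_one_le y x
      rw [abs_sub_comm y x] at hm
      rw [e, abs_mul, abs_mul, abs_mul, abs_of_nonneg hc]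
      calc c * (|α t x + α t y| * (|β1 t| * |(max y 1)⁻¹ - (max x 1)⁻¹|))
          ≤ c * (4 * B * (B * |x - y|)) := by
            gcongr
            exact hb1 t ht
        _ = c * (4 * B ^ 2) * |x - y| := by ring
    · exact continuousOn_const.mul ((hβ3.add (hβ1.mul continuousOn_const)).pow 2)
    · rw [Real.norm_eq_abs, abs_mul, abs_of_nonneg hc, abs_pow]
      calc c * |α t x| ^ 2 ≤ c * (2 * B) ^ 2 := by
            gcongr
            exact hαB t ht x
        _ = c * (4 * B ^ 2) := by ring
    · simp [hT]
  obtain ⟨w, hw0, hw⟩ := hPL.exists_eq_forall_mem_Icc_hasDerivWithinAt₀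
  have hmono : MonotoneOn w (Icc 0 T) :=
    monotoneOn_of_hasDerivWithinAt_nonneg (convex_Icc 0 T) (HasDerivWithinAt.continuousOn hw)
      (fun t ht => (hw t (interior_subset ht)).mono interior_subset)
      (fun t _ => by positivity)
  refine ⟨w, hw0, fun t ht => ?_⟩
  have h1 : 1 ≤ w t := hw0 ▸ hmono h0 ht ht.1
  refine ⟨h1, ?_⟩
  have := hw t ht
  simpa only [hα, max_eq_left h1] using this

theorem NFLearnSol.eq_one_sub_div {T σY γo : ℝ} {β1 β3 γ χ : ℝ → ℝ} (hγo : γo ≠ 0)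
    (hβ1 : ContinuousOn β1 (Icc 0 T)) (hβ3 : ContinuousOn β3 (Icc 0 T))
    (h : NFLearnSol T σY γo β1 β3 γ χ) :
    ∀ t ∈ Icc (0 : ℝ) T, χ t = 1 - γ t / γo := by
  obtain ⟨hγ, hχ, hγ', hχ', hγ0, hχ0⟩ := h
  have hγc := hγ.continuousOn
  have hχc := hχ.continuousOn
  have key := eq_zero_of_hasDerivWithinAt_mul_self (a := 0) (b := T)
    (f := fun t => χ t - (1 - γ t / γo))
    (g := fun t => -(γ t * (β3 t + β1 t * χ t) ^ 2 / σY ^ 2))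
    (by fun_prop)
    (fun t ht => ((hχ' t ht).sub (((hγ' t ht).div_const γo).const_sub 1)).congr_deriv
      (by field_simp; ring))
    (by simp [hγ0, hχ0, hγo])
  exact fun t ht => sub_eq_zero.1 (key t ht)

theorem NFLearnSol.unique {T σY γo : ℝ} {β1 β3 γ₁ χ₁ γ₂ χ₂ : ℝ → ℝ} (hγo : γo ≠ 0)
    (hβ1 : ContinuousOn β1 (Icc 0 T)) (hβ3 : ContinuousOn β3 (Icc 0 T))
    (h₁ : NFLearnSol T σY γo β1 β3 γ₁ χ₁) (h₂ : NFLearnSol T σY γo β1 β3 γ₂ χ₂) :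
    ∀ t ∈ Icc (0 : ℝ) T, γ₁ t = γ₂ t ∧ χ₁ t = χ₂ t := by
  have e₁ := h₁.eq_one_sub_div hγo hβ1 hβ3
  have e₂ := h₂.eq_one_sub_div hγo hβ1 hβ3
  obtain ⟨hγ₁, -, hγ₁', -, h₁0, -⟩ := h₁
  obtain ⟨hγ₂, -, hγ₂', -, h₂0, -⟩ := h₂
  have hc₁ := hγ₁.continuousOn
  have hc₂ := hγ₂.continuousOn
  have key := eq_zero_of_hasDerivWithinAt_mul_self (a := 0) (b := T)
    (f := fun t => γ₁ t - γ₂ t)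
    (g := fun t => -((β3 t + β1 t - β1 t * (γ₁ t + γ₂ t) / γo) *
      (γ₁ t * (β3 t + β1 t * (1 - γ₁ t / γo)) + γ₂ t * (β3 t + β1 t * (1 - γ₂ t / γo)))
        / σY ^ 2))
    (by fun_prop)
    (fun t ht => ((hγ₁' t ht).sub (hγ₂' t ht)).congr_deriv
      (by rw [e₁ t ht, e₂ t ht]; ring))
    (by simp [h₁0, h₂0])
  intro t ht
  have hγ : γ₁ t = γ₂ t := sub_eq_zero.1 (key t ht)
  exact ⟨hγ, by rw [e₁ t ht, e₂ t ht, hγ]⟩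

theorem exists_NFLearnSol {T σY γo : ℝ} (hT : 0 < T) (hσY : σY ≠ 0) (hγo : 0 < γo)
    {β1 β3 : ℝ → ℝ}
    (hβ1 : ContinuousOn β1 (Icc 0 T)) (hβ3 : ContinuousOn β3 (Icc 0 T)) :
    ∃ γ χ : ℝ → ℝ, NFLearnSol T σY γo β1 β3 γ χ := by
  obtain ⟨w, hw0, hw⟩ :=
    exists_precision_solution hT.le (by positivity : 0 ≤ γo / σY ^ 2) hβ1 hβ3
  have hpos : ∀ t ∈ Icc (0 : ℝ) T, w t ≠ 0 := fun t ht => (one_pos.trans_le (hw t ht).1).ne'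
  have hinv : ContinuousOn (fun t => (w t)⁻¹) (Icc 0 T) :=
    (HasDerivWithinAt.continuousOn fun t ht => (hw t ht).2).inv₀ hpos
  have hγ : ∀ t ∈ Icc (0 : ℝ) T, HasDerivWithinAt (fun t => γo * (w t)⁻¹)
      (-(γo * (w t)⁻¹) ^ 2 * (β3 t + β1 t * (1 - (w t)⁻¹)) ^ 2 / σY ^ 2) (Icc 0 T) t :=
    fun t ht => (((hw t ht).2.inv (hpos t ht)).const_mul γo).congr_deriv
      (by have := hpos t ht; field_simp)
  have hχ : ∀ t ∈ Icc (0 : ℝ) T, HasDerivWithinAt (fun t => 1 - (w t)⁻¹)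
      (γo * (w t)⁻¹ * (β3 t + β1 t * (1 - (w t)⁻¹)) ^ 2 * (1 - (1 - (w t)⁻¹)) / σY ^ 2)
      (Icc 0 T) t :=
    fun t ht => (((hw t ht).2.inv (hpos t ht)).const_sub 1).congr_deriv
      (by have := hpos t ht; field_simp; ring)
  exact ⟨_, _, contDiffOn_one_Icc_of_hasDerivWithinAt hT hγ (by fun_prop),
    contDiffOn_one_Icc_of_hasDerivWithinAt hT hχ (by fun_prop), hγ, hχ,
    by simp [hw0], by simp [hw0]⟩

/-- In the no-feedback case the learning ODEs have a unique solution, which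
satisfies `χ = 1 − γ/γ°`. -/
theorem stmt_9 (T σY γo : ℝ) (hT : 0 < T) (hσY : 0 < σY) (hγo : 0 < γo)
    (β1 β3 : ℝ → ℝ)
    (hβ1 : ContinuousOn β1 (Icc 0 T)) (hβ3 : ContinuousOn β3 (Icc 0 T)) :
    ∃ γ χ : ℝ → ℝ, NFLearnSol T σY γo β1 β3 γ χ ∧
      (∀ γ' χ' : ℝ → ℝ, NFLearnSol T σY γo β1 β3 γ' χ' →
        ∀ t ∈ Icc (0:ℝ) T, γ' t = γ t ∧ χ' t = χ t) ∧
      (∀ t ∈ Icc (0:ℝ) T, χ t = 1 - γ t / γo) := by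
  obtain ⟨γ, χ, h⟩ := exists_NFLearnSol hT hσY.ne' hγo hβ1 hβ3
  exact ⟨γ, χ, h, fun _ _ h' => h'.unique hγo.ne' hβ1 hβ3 h, h.eq_one_sub_div hγo.ne' hβ1 hβ3⟩
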